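/- Let C and C' be two 10-element subsets of the unit sphere S³ ⊆ ℝ⁴ such that in each of them any two distinct points have inner product at most 1/6. Then there exists a linear isometry (orthogonal transformation) T of ℝ⁴ with T(C) = C'. (The (4,10,1/6) spherical code is unique up to orthogonal transformations.) -/

import Mathlib

open scoped RealInnerProductSpace

namespace Petersen

abbrev E4 := EuclideanSpace ℝ (Fin 4)

/-- Rescaled inner product: `0` at `1/6`, `1` at `-2/3`, `-1` at `1`. -/
noncomputable def al (x y : E4) : ℝ := (1 - 6 * ⟪x, y⟫) / 5

noncomputable def l1 (a : ℝ) : ℝ := (a - 1/5) - 1255/507 * (a^2 - 2/5) + 115/507 * (a^3 - 1/5)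
noncomputable def l2 (a : ℝ) : ℝ := (a^2 - 2/5) - 56311/80455 * (a^3 - 1/5)
noncomputable def l3 (a : ℝ) : ℝ := a^3 - 1/5
noncomputable def m1 (a : ℝ) : ℝ := 1 + 250/187 * a - 125/187 * a^2
noncomputable def m2 (a : ℝ) : ℝ := a + 2869/2116 * a^2
noncomputable def m3 (a : ℝ) : ℝ := a^2
/-- inner product of the projections of `y`, `z` onto the complement of `x` -/
noncomputable def wt (a b c : ℝ) : ℝ := (1 - 5*c)/6 - (1 - 5*a)/6 * ((1 - 5*b)/6)

noncomputable def K (a b c : ℝ) : ℝ :=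
  169/60 * (l1 a * l1 b) + 80455/18252 * (l2 a * l2 b) + 1857481/241365 * (l3 a * l3 b)
  + 187/125 * (m1 a * m1 b * wt a b c) + 4232/935 * (m2 a * m2 b * wt a b c)
  + 28623/5290 * (m3 a * m3 b * wt a b c)
  + 2808/250 * (((1 - 5*c)/6)^2 - 1/4)

noncomputable def P (a b c : ℝ) : ℝ :=
  K a b c + (K a (-1) a + K a a (-1) + K (-1) a a) / 8 + K (-1) (-1) (-1) / 72

noncomputable def H (a b c : ℝ) : ℝ :=
  a * (((1-a) - 3/4 * (a*(1-a)) - 4 * (b*c))^2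
    + 15/16 * (a*(1-a) - 8/15 * ((1-a)*(b+c)) - 16/15 * (b*c))^2
    + 56/15 * ((1-a)*(b+c) + 67/56 * (b*c) - 15/56 * (b*(b-1)+c*(c-1)))^2
    + 201/56 * (b*c + 11/201 * (b*(b-1)+c*(c-1)))^2
    + 145/201 * (b*(b-1)+c*(c-1))^2)

theorem key_identity (a b c : ℝ) :
    P a b c + P a c b + P b a c + P b c a + P c a b + P c b a
      = - (2 * (H a b c + H b a c + H c a b)) := by
  simp only [P, H, K, l1, l2, l3, m1, m2, m3, wt]
  ring

theorem H_nonneg (a b c : ℝ) (ha : 0 ≤ a) : 0 ≤ H a b c := by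
  unfold H; positivity

theorem five_sq (p q r s t : ℝ)
    (h : p^2 + 15/16 * q^2 + 56/15 * r^2 + 201/56 * s^2 + 145/201 * t^2 = 0) :
    q = 0 ∧ r = 0 ∧ s = 0 ∧ t = 0 := by
  have hp := sq_nonneg p
  have hq := sq_nonneg q
  have hr := sq_nonneg r
  have hs := sq_nonneg s
  have ht := sq_nonneg t
  refine ⟨?_, ?_, ?_, ?_⟩ <;> apply pow_eq_zero_iff (two_ne_zero) |>.1 <;> linarith

theorem H_zero (a b c : ℝ) (h : H a b c = 0) : a = 0 ∨ a = 1 := by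
  unfold H at h
  rcases mul_eq_zero.1 h with h | h
  · exact Or.inl h
  · obtain ⟨e2, e3, e4, e5⟩ := five_sq _ _ _ _ _ h
    rw [e5] at e4 e3
    have f4 : b * c = 0 := by linarith
    rw [f4] at e3 e2
    have f3 : (1-a)*(b+c) = 0 := by linarith
    rw [f3] at e2
    have f2 : a * (1-a) = 0 := by linarith
    rcases mul_eq_zero.1 f2 with h | h
    · exact Or.inl h
    · right; linarith

theorem frame_ineq (C : Finset E4) (hcard : C.card = 10) (hunit : ∀ c ∈ C, ‖c‖ = 1) :
    25 ≤ ∑ x ∈ C, ∑ y ∈ C, ⟪x, y⟫ ^ 2 := by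
  set m : Fin 4 → Fin 4 → ℝ := fun i j => ∑ x ∈ C, x i * x j with hm
  have h1 : ∑ x ∈ C, ∑ y ∈ C, ⟪x, y⟫ ^ 2 = ∑ i, ∑ j, (m i j) ^ 2 := by
    have : ∀ x y : E4, ⟪x, y⟫ ^ 2 = ∑ i, ∑ j, (x i * x j) * (y i * y j) := by
      intro x y
      rw [PiLp.inner_apply, sq, Finset.sum_mul_sum]
      refine Finset.sum_congr rfl fun i _ => Finset.sum_congr rfl fun j _ => ?_
      simp; ring
    simp_rw [this]
    have h2 : ∀ x ∈ C, ∑ y ∈ C, ∑ i, ∑ j, (x i * x j) * (y i * y j)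
        = ∑ i, ∑ j, (x i * x j) * m i j := by
      intro x _
      rw [Finset.sum_comm]
      refine Finset.sum_congr rfl fun i _ => ?_
      rw [Finset.sum_comm]
      refine Finset.sum_congr rfl fun j _ => ?_
      rw [hm, Finset.mul_sum]
    rw [Finset.sum_congr rfl h2, Finset.sum_comm]
    refine Finset.sum_congr rfl fun i _ => ?_
    rw [Finset.sum_comm]
    refine Finset.sum_congr rfl fun j _ => ?_
    rw [← Finset.sum_mul, sq]
  have h3 : ∑ i, m i i = 10 := by
    simp only [hm]
    rw [Finset.sum_comm]
    have : ∀ x ∈ C, ∑ i, x i * x i = 1 := by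
      intro x hx
      have := EuclideanSpace.real_norm_sq_eq x
      rw [hunit x hx] at this
      simp only [sq] at this
      linarith
    rw [Finset.sum_congr rfl this]; simp [hcard]
  rw [h1]
  simp only [Fin.sum_univ_four] at h3 ⊢
  nlinarith [sq_nonneg (m 0 0 - m 1 1), sq_nonneg (m 0 0 - m 2 2), sq_nonneg (m 0 0 - m 3 3),
    sq_nonneg (m 1 1 - m 2 2), sq_nonneg (m 1 1 - m 3 3), sq_nonneg (m 2 2 - m 3 3),
    sq_nonneg (m 0 1), sq_nonneg (m 0 2), sq_nonneg (m 0 3), sq_nonneg (m 1 0), sq_nonneg (m 1 2),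
    sq_nonneg (m 1 3), sq_nonneg (m 2 0), sq_nonneg (m 2 1), sq_nonneg (m 2 3), sq_nonneg (m 3 0),
    sq_nonneg (m 3 1), sq_nonneg (m 3 2), congrArg (fun t => t^2) h3]

theorem sq_sum' (C : Finset E4) (p : E4 → ℝ) :
    ∑ y ∈ C, ∑ z ∈ C, p y * p z = (∑ y ∈ C, p y) ^ 2 := by
  rw [sq, Finset.sum_mul_sum]

theorem proj_sum (C : Finset E4) (x : E4) (hx : ‖x‖ = 1) (p : E4 → ℝ) :
    0 ≤ ∑ y ∈ C, ∑ z ∈ C, p y * p z * wt (al x y) (al x z) (al y z) := by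
  have hxx : ⟪x, x⟫ = (1 : ℝ) := by rw [real_inner_self_eq_norm_sq, hx]; norm_num
  have : ∑ y ∈ C, ∑ z ∈ C, p y * p z * wt (al x y) (al x z) (al y z)
      = ⟪∑ y ∈ C, p y • (y - ⟪x, y⟫ • x), ∑ z ∈ C, p z • (z - ⟪x, z⟫ • x)⟫ := by
    rw [sum_inner]
    refine Finset.sum_congr rfl fun y _ => ?_
    rw [inner_sum]
    refine Finset.sum_congr rfl fun z _ => ?_
    simp only [inner_smul_left, inner_smul_right, inner_sub_left, inner_sub_right, hxx, wt, al,
      real_inner_comm x y]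
    simp
    ring
  rw [this]
  exact real_inner_self_nonneg

/-- sum over ordered triples of distinct points -/
noncomputable def S3 (C : Finset E4) (f : E4 → E4 → E4 → ℝ) : ℝ := by
  classical
  exact ∑ x ∈ C, ∑ y ∈ C.erase x, ∑ z ∈ (C.erase x).erase y, f x y z

theorem S3_swap23 (C : Finset E4) (f : E4 → E4 → E4 → ℝ) :
    S3 C (fun x y z => f x z y) = S3 C f := by
  classical
  unfold S3
  refine Finset.sum_congr rfl fun x _ => ?_
  apply Finset.sum_comm'
  intro y z; simp only [Finset.mem_erase]; tauto

theorem S3_swap12 (C : Finset E4) (f : E4 → E4 → E4 → ℝ) :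
    S3 C (fun x y z => f y x z) = S3 C f := by
  classical
  unfold S3
  rw [Finset.sum_comm' (t' := C) (s' := fun y => C.erase y)]
  · refine Finset.sum_congr rfl fun x _ => Finset.sum_congr rfl fun y _ => ?_
    rw [Finset.erase_right_comm]
  · intro y z; simp only [Finset.mem_erase]; tauto

theorem S3_add (C : Finset E4) (f g : E4 → E4 → E4 → ℝ) :
    S3 C (fun x y z => f x y z + g x y z) = S3 C f + S3 C g := by
  classical
  simp [S3, Finset.sum_add_distrib]

theorem sum_eq_S3 (C : Finset E4) (hcard : C.card = 10) (f : E4 → E4 → E4 → ℝ) :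
    ∑ x ∈ C, ∑ y ∈ C, ∑ z ∈ C, f x y z
      = S3 C (fun x y z => f x y z + (f x y x + f x y y + f x x y) / 8 + f x x x / 72) := by
  classical
  unfold S3
  refine Finset.sum_congr rfl fun x hx => ?_
  have c1 : (C.erase x).card = 9 := by rw [Finset.card_erase_of_mem hx, hcard]
  have h1 : ∀ y ∈ C.erase x, ∑ z ∈ (C.erase x).erase y,
      (f x y z + (f x y x + f x y y + f x x y) / 8 + f x x x / 72)
      = ∑ z ∈ C, f x y z + f x x y + f x x x / 9 := by
    intro y hy
    have c2 : ((C.erase x).erase y).card = 8 := by rw [Finset.card_erase_of_mem hy, c1]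
    rw [Finset.sum_add_distrib, Finset.sum_add_distrib, Finset.sum_const, Finset.sum_const, c2,
      ← Finset.add_sum_erase C _ hx, ← Finset.add_sum_erase (C.erase x) _ hy]
    simp only [nsmul_eq_mul]; push_cast; ring
  rw [Finset.sum_congr rfl h1, Finset.sum_add_distrib, Finset.sum_add_distrib, Finset.sum_const, c1,
    ← Finset.add_sum_erase C _ hx, ← Finset.add_sum_erase C (fun z => f x x z) hx]
  simp only [nsmul_eq_mul]; push_cast; ring

theorem al_self (x : E4) (hx : ‖x‖ = 1) : al x x = -1 := by
  unfold al; rw [real_inner_self_eq_norm_sq, hx]; norm_num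

theorem al_comm (x y : E4) : al x y = al y x := by
  unfold al; rw [real_inner_comm]

theorem K_sum (C : Finset E4) (hcard : C.card = 10) (hunit : ∀ c ∈ C, ‖c‖ = 1) :
    ∑ x ∈ C, (1857481/241365 : ℝ) * (∑ y ∈ C, l3 (al x y)) ^ 2 ≤
    ∑ x ∈ C, ∑ y ∈ C, ∑ z ∈ C, K (al x y) (al x z) (al y z) := by
  have h1 : ∀ x ∈ C, (1857481/241365 : ℝ) * (∑ y ∈ C, l3 (al x y)) ^ 2
      + 2808/250 * (∑ y ∈ C, ∑ z ∈ C, ⟪y, z⟫ ^ 2 - 25) ≤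
      ∑ y ∈ C, ∑ z ∈ C, K (al x y) (al x z) (al y z) := by
    intro x hx
    have a1 := sq_nonneg (∑ y ∈ C, l1 (al x y))
    have a2 := sq_nonneg (∑ y ∈ C, l2 (al x y))
    have b1 := proj_sum C x (hunit x hx) (fun y => m1 (al x y))
    have b2 := proj_sum C x (hunit x hx) (fun y => m2 (al x y))
    have b3 := proj_sum C x (hunit x hx) (fun y => m3 (al x y))
    have e : ∑ y ∈ C, ∑ z ∈ C, (((1 - 5 * al y z)/6)^2 - 1/4)
        = ∑ y ∈ C, ∑ z ∈ C, ⟪y, z⟫ ^ 2 - 25 := by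
      simp only [Finset.sum_sub_distrib, Finset.sum_const, hcard, nsmul_eq_mul]
      congr 1
      · refine Finset.sum_congr rfl fun y _ => Finset.sum_congr rfl fun z _ => ?_
        unfold al; ring
      · norm_num
    rw [← e]
    rw [← sq_sum'] at a1 a2 ⊢
    unfold K
    simp only [Finset.sum_add_distrib, ← Finset.mul_sum] at *
    linarith
  have h2 := Finset.sum_le_sum h1
  rw [Finset.sum_add_distrib, Finset.sum_const, hcard] at h2
  have h3 := frame_ineq C hcard hunit
  refine le_trans ?_ h2
  simp only [nsmul_eq_mul]
  linarith

theorem S3_congr (C : Finset E4) (f g : E4 → E4 → E4 → ℝ)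
    (h : ∀ x ∈ C, ∀ y ∈ C, ∀ z ∈ C, x ≠ y → x ≠ z → y ≠ z → f x y z = g x y z) :
    S3 C f = S3 C g := by
  classical
  unfold S3
  refine Finset.sum_congr rfl fun x hx => Finset.sum_congr rfl fun y hy =>
    Finset.sum_congr rfl fun z hz => ?_
  simp only [Finset.mem_erase] at hy hz
  exact h x hx y hy.2 z hz.2.2 (Ne.symm hy.1) (Ne.symm hz.2.1) (Ne.symm hz.1)

theorem S3_P (C : Finset E4) (hcard : C.card = 10) (hunit : ∀ c ∈ C, ‖c‖ = 1) :
    ∑ x ∈ C, ∑ y ∈ C, ∑ z ∈ C, K (al x y) (al x z) (al y z)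
      = S3 C (fun x y z => P (al x y) (al x z) (al y z)) := by
  rw [sum_eq_S3 C hcard]
  apply S3_congr
  intro x hx y hy z hz _ _ _
  simp only [al_self x (hunit x hx), al_self y (hunit y hy), al_comm y x, P]

theorem S3_H (C : Finset E4) :
    3 * S3 C (fun x y z => P (al x y) (al x z) (al y z)) = - S3 C (fun x y z =>
      H (al x y) (al x z) (al y z) + H (al x z) (al x y) (al y z)
        + H (al y z) (al x y) (al x z)) := by
  set f : E4 → E4 → E4 → ℝ := fun x y z => P (al x y) (al x z) (al y z) with hf
  have e1 : S3 C (fun x y z => f x z y) = S3 C f := S3_swap23 C f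
  have e2 : S3 C (fun x y z => f y x z) = S3 C f := S3_swap12 C f
  have e3 : S3 C (fun x y z => f y z x) = S3 C f := by
    rw [← e1]; exact S3_swap12 C (fun x y z => f x z y)
  have e4 : S3 C (fun x y z => f z x y) = S3 C f := by
    rw [← e2]; exact S3_swap23 C (fun x y z => f y x z)
  have e5 : S3 C (fun x y z => f z y x) = S3 C f := by
    rw [← e3]; exact S3_swap23 C (fun x y z => f y z x)
  have e : S3 C (fun x y z => f x y z + f x z y + f y x z + f y z x + f z x y + f z y x)
      = 6 * S3 C f := by
    rw [S3_add, S3_add, S3_add, S3_add, S3_add, e1, e2, e3, e4, e5]; ring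
  have e' : S3 C (fun x y z => f x y z + f x z y + f y x z + f y z x + f z x y + f z y x)
      = -2 * S3 C (fun x y z =>
      H (al x y) (al x z) (al y z) + H (al x z) (al x y) (al y z)
        + H (al y z) (al x y) (al x z)) := by
    classical
    unfold S3
    simp only [Finset.mul_sum]
    refine Finset.sum_congr rfl fun x hx => Finset.sum_congr rfl fun y hy =>
      Finset.sum_congr rfl fun z hz => ?_
    have := key_identity (al x y) (al x z) (al y z)
    simp only [hf, al_comm y x, al_comm z x, al_comm z y]
    linarith
  linarith

theorem main_facts (C : Finset E4) (hcard : C.card = 10) (hunit : ∀ c ∈ C, ‖c‖ = 1)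
    (hinner : ∀ c ∈ C, ∀ c' ∈ C, c ≠ c' → ⟪c, c'⟫ ≤ (1 / 6 : ℝ)) :
    (∀ x ∈ C, ∀ y ∈ C, x ≠ y → al x y = 0 ∨ al x y = 1) ∧
    (∀ x ∈ C, ∑ y ∈ C, l3 (al x y) = 0) := by
  classical
  have hal : ∀ x ∈ C, ∀ y ∈ C, x ≠ y → 0 ≤ al x y := by
    intro x hx y hy hxy
    have := hinner x hx y hy hxy
    unfold al; linarith
  have hH : ∀ x ∈ C, ∀ y ∈ C.erase x, ∀ z ∈ (C.erase x).erase y,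
      0 ≤ H (al x y) (al x z) (al y z) ∧ 0 ≤ H (al x z) (al x y) (al y z)
        ∧ 0 ≤ H (al y z) (al x y) (al x z) := by
    intro x hx y hy z hz
    simp only [Finset.mem_erase] at hy hz
    exact ⟨H_nonneg _ _ _ (hal x hx y hy.2 (Ne.symm hy.1)),
      H_nonneg _ _ _ (hal x hx z hz.2.2 (Ne.symm hz.2.1)),
      H_nonneg _ _ _ (hal y hy.2 z hz.2.2 (Ne.symm hz.1))⟩
  have k1 := K_sum C hcard hunit
  rw [S3_P C hcard hunit] at k1
  have k2 := S3_H C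
  have hz : ∀ x ∈ C, ∀ y ∈ C.erase x, 0 ≤ ∑ z ∈ (C.erase x).erase y,
      (H (al x y) (al x z) (al y z) + H (al x z) (al x y) (al y z)
        + H (al y z) (al x y) (al x z)) := fun x hx y hy =>
    Finset.sum_nonneg fun z hz => by
      obtain ⟨h1, h2, h3⟩ := hH x hx y hy z hz; linarith
  have hy : ∀ x ∈ C, 0 ≤ ∑ y ∈ C.erase x, ∑ z ∈ (C.erase x).erase y,
      (H (al x y) (al x z) (al y z) + H (al x z) (al x y) (al y z)
        + H (al y z) (al x y) (al x z)) := fun x hx =>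
    Finset.sum_nonneg fun y hy => hz x hx y hy
  have k3 : 0 ≤ S3 C (fun x y z =>
      H (al x y) (al x z) (al y z) + H (al x z) (al x y) (al y z)
        + H (al y z) (al x y) (al x z)) := Finset.sum_nonneg hy
  have k4 : ∀ x ∈ C, 0 ≤ (1857481/241365 : ℝ) * (∑ y ∈ C, l3 (al x y)) ^ 2 :=
    fun x _ => by positivity
  have k5 := Finset.sum_nonneg k4
  constructor
  · have z0 : S3 C (fun x y z =>
      H (al x y) (al x z) (al y z) + H (al x z) (al x y) (al y z)
        + H (al y z) (al x y) (al x z)) = 0 := by linarith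
    intro x hx y hyC hxy
    have hye : y ∈ C.erase x := Finset.mem_erase.2 ⟨Ne.symm hxy, hyC⟩
    have z1 := (Finset.sum_eq_zero_iff_of_nonneg hy).1 z0 x hx
    have z2 := (Finset.sum_eq_zero_iff_of_nonneg (hz x hx)).1 z1 y hye
    have hne : ((C.erase x).erase y).Nonempty := by
      rw [← Finset.card_pos, Finset.card_erase_of_mem hye, Finset.card_erase_of_mem hx, hcard]
      norm_num
    obtain ⟨z, hzm⟩ := hne
    have z3 := (Finset.sum_eq_zero_iff_of_nonneg (fun z hz => by
      obtain ⟨h1, h2, h3⟩ := hH x hx y hye z hz; linarith)).1 z2 z hzm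
    obtain ⟨h1, h2, h3⟩ := hH x hx y hye z hzm
    exact H_zero _ _ _ (by linarith)
  · have z0 : ∑ x ∈ C, (1857481/241365 : ℝ) * (∑ y ∈ C, l3 (al x y)) ^ 2 = 0 := by linarith
    intro x hx
    have z1 := (Finset.sum_eq_zero_iff_of_nonneg k4).1 z0 x hx
    apply pow_eq_zero_iff (two_ne_zero) |>.1
    linarith

/-- the neighbours of `x`: the points of `C` at inner product `-2/3` -/
theorem degree (C : Finset E4) (hcard : C.card = 10) (hunit : ∀ c ∈ C, ‖c‖ = 1)
    (hinner : ∀ c ∈ C, ∀ c' ∈ C, c ≠ c' → ⟪c, c'⟫ ≤ (1 / 6 : ℝ)) (x : E4) (hx : x ∈ C) :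
    (C.filter (fun y => al x y = 1)).card = 3 := by
  classical
  obtain ⟨h1, h2⟩ := main_facts C hcard hunit hinner
  have h3 := h2 x hx
  have h4 : ∀ y ∈ C.erase x, l3 (al x y) = (if al x y = 1 then 1 else 0) - 1/5 := by
    intro y hy
    rw [Finset.mem_erase] at hy
    rcases h1 x hx y hy.2 (Ne.symm hy.1) with h | h <;> rw [h] <;> norm_num [l3]
  rw [← Finset.add_sum_erase C _ hx, Finset.sum_congr rfl h4, Finset.sum_sub_distrib,
    Finset.sum_const, Finset.card_erase_of_mem hx, hcard, Finset.sum_boole,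
    al_self x (hunit x hx)] at h3
  have h5 : (C.erase x).filter (fun y => al x y = 1) = C.filter (fun y => al x y = 1) := by
    ext y
    simp only [Finset.mem_filter, Finset.mem_erase]
    constructor
    · tauto
    · rintro ⟨ha, hb⟩
      refine ⟨⟨?_, ha⟩, hb⟩
      rintro rfl
      rw [al_self y (hunit y ha)] at hb; norm_num at hb
  rw [h5] at h3
  norm_num [l3] at h3
  have : ((C.filter (fun y => al x y = 1)).card : ℝ) = 3 := by linarith
  exact_mod_cast this


noncomputable def Gm : Fin 4 → Fin 4 → ℝ :=
  ![![1, -2/3, 1/6, 1/6], ![-2/3, 1, -2/3, 1/6], ![1/6, -2/3, 1, -2/3], ![1/6, 1/6, -2/3, 1]]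

theorem al_one {x y : E4} : al x y = 1 ↔ ⟪x, y⟫ = (-2/3 : ℝ) := by
  unfold al; constructor <;> intro h <;> linarith

theorem al_zero {x y : E4} : al x y = 0 ↔ ⟪x, y⟫ = (1/6 : ℝ) := by
  unfold al; constructor <;> intro h <;> linarith

theorem exists_path (C : Finset E4) (hcard : C.card = 10) (hunit : ∀ c ∈ C, ‖c‖ = 1)
    (hinner : ∀ c ∈ C, ∀ c' ∈ C, c ≠ c' → ⟪c, c'⟫ ≤ (1 / 6 : ℝ)) :
    ∃ b : Fin 4 → E4, (∀ i, b i ∈ C) ∧ ∀ i j, ⟪b i, b j⟫ = Gm i j := by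
  classical
  obtain ⟨h1, -⟩ := main_facts C hcard hunit hinner
  have two : ∀ x ∈ C, ∀ y ∈ C, x ≠ y → ⟪x, y⟫ = (1/6 : ℝ) ∨ ⟪x, y⟫ = (-2/3 : ℝ) := by
    intro x hx y hy hxy
    rw [← al_one, ← al_zero]; exact h1 x hx y hy hxy
  have self : ∀ x ∈ C, ⟪x, x⟫ = (1 : ℝ) := by
    intro x hx; rw [real_inner_self_eq_norm_sq, hunit x hx]; norm_num
  have deg := degree C hcard hunit hinner
  have tri : ∀ x ∈ C, ∀ y ∈ C, ∀ z ∈ C, ⟪x, y⟫ = (-2/3 : ℝ) → ⟪x, z⟫ = (-2/3 : ℝ) →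
      ⟪y, z⟫ = (-2/3 : ℝ) → False := by
    intro x hx y hy z hz a b c
    have := real_inner_self_nonneg (x := x + y + z)
    simp only [inner_add_left, inner_add_right, self x hx, self y hy, self z hz,
      real_inner_comm x y, real_inner_comm x z, real_inner_comm y z, a, b, c] at this
    norm_num at this
  -- a vertex and two neighbours
  have nb : ∀ x ∈ C, ∀ w ∈ C, ∃ y ∈ C, y ≠ w ∧ ⟪x, y⟫ = (-2/3 : ℝ) := by
    intro x hx w hw
    have : 0 < ((C.filter (fun y => al x y = 1)).erase w).card := by
      have := Finset.pred_card_le_card_erase (s := C.filter (fun y => al x y = 1)) (a := w)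
      rw [deg x hx] at this
      omega
    obtain ⟨y, hy⟩ := Finset.card_pos.1 this
    simp only [Finset.mem_erase, Finset.mem_filter] at hy
    exact ⟨y, hy.2.1, hy.1, al_one.1 hy.2.2⟩
  obtain ⟨x, hx⟩ : C.Nonempty := by rw [← Finset.card_pos, hcard]; norm_num
  obtain ⟨a, ha, -, hxa⟩ := nb x hx x hx
  obtain ⟨b, hb, hba, hxb⟩ := nb x hx a ha
  obtain ⟨p, hp, hpx, hap⟩ := nb a ha x hx
  have hab : ⟪a, b⟫ = (1/6 : ℝ) := by
    rcases two a ha b hb (Ne.symm hba) with h | h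
    · exact h
    · exact (tri x hx a ha b hb hxa hxb h).elim
  have hxp : ⟪x, p⟫ = (1/6 : ℝ) := by
    rcases two x hx p hp (Ne.symm hpx) with h | h
    · exact h
    · exact (tri x hx a ha p hp hxa h hap).elim
  have hbp : ⟪b, p⟫ = (1/6 : ℝ) := by
    have hne : b ≠ p := by
      rintro rfl; rw [hxb] at hxp; norm_num at hxp
    rcases two b hb p hp hne with h | h
    · exact h
    · exfalso
      have := real_inner_self_nonneg (x := x + a + b + p)
      simp only [inner_add_left, inner_add_right, self x hx, self a ha, self b hb, self p hp,
        real_inner_comm x a, real_inner_comm x b, real_inner_comm x p, real_inner_comm a b,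
        real_inner_comm a p, real_inner_comm b p, hxa, hxb, hap, hab, hxp, h] at this
      norm_num at this
  refine ⟨![b, x, a, p], ?_, ?_⟩
  · intro i; fin_cases i <;> simp [*]
  · intro i j
    fin_cases i <;> fin_cases j <;>
      simp [Gm, hunit x hx, hunit a ha, hunit b hb,
        hunit p hp,
        real_inner_comm x a, real_inner_comm x b, real_inner_comm x p, real_inner_comm a b,
        real_inner_comm a p, real_inner_comm b p, hxa, hxb, hap, hab, hxp, hbp]

theorem path_li (b : Fin 4 → E4) (hG : ∀ i j, ⟪b i, b j⟫ = Gm i j) : LinearIndependent ℝ b := by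
  rw [Fintype.linearIndependent_iff]
  intro g hg
  have key : ∀ j, ∑ i, g i * Gm i j = 0 := by
    intro j
    have := congrArg (fun v => ⟪v, b j⟫) hg
    simpa [sum_inner, inner_smul_left, hG] using this
  have k0 := key 0
  have k1 := key 1
  have k2 := key 2
  have k3 := key 3
  simp [Fin.sum_univ_four, Gm] at k0 k1 k2 k3
  intro i
  fin_cases i <;> simp <;> linarith

/-- The basis given by an induced path. -/
noncomputable def pathBasis (b : Fin 4 → E4) (hG : ∀ i j, ⟪b i, b j⟫ = Gm i j) :
    Module.Basis (Fin 4) ℝ E4 :=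
  basisOfLinearIndependentOfCardEqFinrank (path_li b hG) (by simp)

theorem pathBasis_apply (b : Fin 4 → E4) (hG : ∀ i j, ⟪b i, b j⟫ = Gm i j) (i : Fin 4) :
    pathBasis b hG i = b i := by simp [pathBasis]

theorem ext_path (b : Fin 4 → E4) (hG : ∀ i j, ⟪b i, b j⟫ = Gm i j) (y z : E4)
    (h : ∀ i, ⟪y, b i⟫ = ⟪z, b i⟫) : y = z := by
  apply InnerProductSpace.ext_inner_right_basis (pathBasis b hG)
  intro i
  rw [pathBasis_apply]; exact h i

/-- the six admissible inner product patterns of the remaining points -/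
noncomputable def pats : Finset (Fin 4 → ℝ) := by
  classical
  exact {![1/6, 1/6, 1/6, 1/6], ![1/6, 1/6, 1/6, -2/3], ![1/6, 1/6, -2/3, 1/6],
    ![1/6, -2/3, 1/6, 1/6], ![-2/3, 1/6, 1/6, 1/6], ![-2/3, 1/6, 1/6, -2/3]}

theorem pats_card : pats.card ≤ 6 := by
  classical
  unfold pats
  exact Finset.card_le_six

theorem mem_pats (b : Fin 4 → E4) (hG : ∀ i j, ⟪b i, b j⟫ = Gm i j) (y : E4) (hy : ‖y‖ = 1)
    (h : ∀ i, ⟪y, b i⟫ = (1/6 : ℝ) ∨ ⟪y, b i⟫ = (-2/3 : ℝ)) : (fun i => ⟪y, b i⟫) ∈ pats := by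
  classical
  obtain ⟨r, hr⟩ : ∃ r : Fin 4 → ℝ, y = ∑ i, r i • b i :=
    ⟨(pathBasis b hG).repr y, by
      conv_lhs => rw [← (pathBasis b hG).sum_repr y]
      simp [pathBasis_apply]⟩
  have key : ∀ j, ⟪y, b j⟫ = ∑ i, r i * Gm i j := by
    intro j
    conv_lhs => rw [hr]
    simp [sum_inner, inner_smul_left, hG]
  have nrm : ∑ i, r i * ⟪y, b i⟫ = 1 := by
    have : ⟪y, y⟫ = (1 : ℝ) := by rw [real_inner_self_eq_norm_sq, hy]; norm_num
    rw [← this]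
    conv_rhs => rw [hr, ← hr]
    conv_rhs => arg 3; rw [hr]
    simp [inner_sum, inner_smul_right]
  have fe : (fun i => ⟪y, b i⟫) = ![⟪y, b 0⟫, ⟪y, b 1⟫, ⟪y, b 2⟫, ⟪y, b 3⟫] := by
    ext i; fin_cases i <;> rfl
  rw [fe]
  have k0 := key 0
  have k1 := key 1
  have k2 := key 2
  have k3 := key 3
  have q0 := h 0
  have q1 := h 1
  have q2 := h 2
  have q3 := h 3
  simp only [Fin.sum_univ_four] at k0 k1 k2 k3 nrm
  generalize ⟪y, b 0⟫ = w0 at *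
  generalize ⟪y, b 1⟫ = w1 at *
  generalize ⟪y, b 2⟫ = w2 at *
  generalize ⟪y, b 3⟫ = w3 at *
  simp [Gm] at k0 k1 k2 k3
  have e0 : r 0 = 12/5 * w0 + 12/5 * w1 + 6/5 * w2 := by linarith
  have e1 : r 1 = 12/5 * w0 + 24/5 * w1 + 18/5 * w2 + 6/5 * w3 := by linarith
  have e2 : r 2 = 6/5 * w0 + 18/5 * w1 + 24/5 * w2 + 12/5 * w3 := by linarith
  have e3 : r 3 = 6/5 * w1 + 12/5 * w2 + 12/5 * w3 := by linarith
  rw [e0, e1, e2, e3] at nrm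
  clear e0 e1 e2 e3 k0 k1 k2 k3 key fe hr h
  rcases q0 with rfl | rfl <;> rcases q1 with rfl | rfl <;> rcases q2 with rfl | rfl <;>
    rcases q3 with rfl | rfl <;> first
      | (exfalso; norm_num at nrm; done)
      | simp [pats]

theorem image_pats (C : Finset E4) (hcard : C.card = 10) (hunit : ∀ c ∈ C, ‖c‖ = 1)
    (hinner : ∀ c ∈ C, ∀ c' ∈ C, c ≠ c' → ⟪c, c'⟫ ≤ (1 / 6 : ℝ))
    (b : Fin 4 → E4) (hb : ∀ i, b i ∈ C) (hG : ∀ i j, ⟪b i, b j⟫ = Gm i j)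
    (y : E4) (hy : y ∈ C) (hyb : ∀ i, y ≠ b i) : (fun i => ⟪y, b i⟫) ∈ pats := by
  apply mem_pats b hG y (hunit y hy)
  intro i
  rw [← al_one, ← al_zero]
  exact (main_facts C hcard hunit hinner).1 y hy (b i) (hb i) (hyb i)

theorem pats_surj (C : Finset E4) (hcard : C.card = 10) (hunit : ∀ c ∈ C, ‖c‖ = 1)
    (hinner : ∀ c ∈ C, ∀ c' ∈ C, c ≠ c' → ⟪c, c'⟫ ≤ (1 / 6 : ℝ))
    (b : Fin 4 → E4) (hb : ∀ i, b i ∈ C) (hG : ∀ i j, ⟪b i, b j⟫ = Gm i j)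
    (w : Fin 4 → ℝ) (hw : w ∈ pats) : ∃ y ∈ C, ∀ i, ⟪y, b i⟫ = w i := by
  classical
  set D := C \ Finset.univ.image b with hD
  have hDc : 6 ≤ D.card := by
    have h1 := Finset.le_card_sdiff (Finset.univ.image b) C
    have h2 : (Finset.univ.image b).card ≤ 4 := by
      simpa using Finset.card_image_le (s := (Finset.univ : Finset (Fin 4))) (f := b)
    rw [hD]; omega
  have hinj : Function.Injective (fun y : E4 => fun i => ⟪y, b i⟫) := by
    intro y z h
    exact ext_path b hG y z (fun i => congrFun h i)
  have himg : D.image (fun y : E4 => fun i => ⟪y, b i⟫) = pats := by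
    apply Finset.eq_of_subset_of_card_le
    · intro v hv
      obtain ⟨y, hy, rfl⟩ := Finset.mem_image.1 hv
      rw [hD, Finset.mem_sdiff] at hy
      refine image_pats C hcard hunit hinner b hb hG y hy.1 ?_
      rintro i rfl
      exact hy.2 (Finset.mem_image_of_mem _ (Finset.mem_univ i))
    · rw [Finset.card_image_of_injective _ hinj]
      exact le_trans pats_card hDc
  rw [← himg] at hw
  obtain ⟨y, hy, rfl⟩ := Finset.mem_image.1 hw
  exact ⟨y, (Finset.mem_sdiff.1 hy).1, fun i => rfl⟩

end Petersen

theorem petersen_unique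
    (C C' : Finset (EuclideanSpace ℝ (Fin 4)))
    (hcard : C.card = 10) (hcard' : C'.card = 10)
    (hunit : ∀ c ∈ C, ‖c‖ = 1) (hunit' : ∀ c ∈ C', ‖c‖ = 1)
    (hinner : ∀ c ∈ C, ∀ c' ∈ C, c ≠ c' → ⟪c, c'⟫ ≤ (1 / 6 : ℝ))
    (hinner' : ∀ c ∈ C', ∀ c' ∈ C', c ≠ c' → ⟪c, c'⟫ ≤ (1 / 6 : ℝ)) :
    ∃ T : EuclideanSpace ℝ (Fin 4) ≃ₗᵢ[ℝ] EuclideanSpace ℝ (Fin 4),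
      T '' (C : Set (EuclideanSpace ℝ (Fin 4))) = (C' : Set (EuclideanSpace ℝ (Fin 4))) := by
  classical
  obtain ⟨b, hb, hG⟩ := Petersen.exists_path C hcard hunit hinner
  obtain ⟨b', hb', hG'⟩ := Petersen.exists_path C' hcard' hunit' hinner'
  set B := Petersen.pathBasis b hG with hB
  set B' := Petersen.pathBasis b' hG' with hB'
  let T0 := B.equiv B' (Equiv.refl _)
  have hT0 : ∀ i, T0 (b i) = b' i := by
    intro i
    have : T0 (B i) = B' i := by simp [T0]
    rwa [hB, hB', Petersen.pathBasis_apply, Petersen.pathBasis_apply] at this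
  have hexp : ∀ y, y = ∑ i, B.repr y i • b i := by
    intro y
    conv_lhs => rw [← B.sum_repr y]
    simp [hB, Petersen.pathBasis_apply]
  have hin : ∀ x y, ⟪T0 x, T0 y⟫ = ⟪x, y⟫ := by
    intro x y
    rw [hexp x, hexp y]
    simp only [map_sum, map_smul, hT0, sum_inner, inner_sum, inner_smul_left, inner_smul_right,
      hG, hG']
  let T : EuclideanSpace ℝ (Fin 4) ≃ₗᵢ[ℝ] EuclideanSpace ℝ (Fin 4) := T0.isometryOfInner hin
  have hT : ∀ y, T y = T0 y := fun y => rfl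
  refine ⟨T, ?_⟩
  have hsub : C.image T ⊆ C' := by
    intro v hv
    obtain ⟨y, hy, rfl⟩ := Finset.mem_image.1 hv
    by_cases hyb : ∃ i, y = b i
    · obtain ⟨i, rfl⟩ := hyb
      rw [hT, hT0]; exact hb' i
    · push Not at hyb
      obtain ⟨z, hz, hzi⟩ := Petersen.pats_surj C' hcard' hunit' hinner' b' hb' hG' _
        (Petersen.image_pats C hcard hunit hinner b hb hG y hy hyb)
      have : T y = z := by
        apply Petersen.ext_path b' hG'
        intro i
        rw [hzi i, hT, ← hT0 i, hin]
      rw [this]; exact hz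
  have heq : C.image T = C' := by
    apply Finset.eq_of_subset_of_card_le hsub
    rw [Finset.card_image_of_injective _ T.injective, hcard, hcard']
  rw [← heq, Finset.coe_image]
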